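/- arXiv:2208.03152 — 3 statements merged into one kernel-verified Lean document; each statement's English description precedes it below -/
import Mathlib

section
/- For every infinite set X ⊆ ℕ, there exists an infinite 2-apart set Y ⊆ ℕ with Y ≤_FS X. -/
namespace Carlson

/-- The domain of a partial function `ℕ →. B`, encoded as `ℕ → Option B`. -/
def dom {B : Type*} (p : ℕ → Option B) : Set ℕ := {n | p n ≠ none}

/-- `p` is a located word over `B`: a partial function with finite nonempty domain. -/
def IsLW {B : Type*} (p : ℕ → Option B) : Prop := (dom p).Finite ∧ (dom p).Nonempty

/-- A located variable word over `A` is a located word over `Option A`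
(where `none` encodes the variable `⋆`) taking the value `⋆` at least once. -/
def IsLVW {A : Type*} (p : ℕ → Option (Option A)) : Prop :=
  IsLW p ∧ ∃ n, p n = some none

/-- `p < q`: every element of the domain of `p` is below every element of the domain of `q`. -/
def blt {B : Type*} (p q : ℕ → Option B) : Prop :=
  ∀ m ∈ dom p, ∀ n ∈ dom q, m < n

/-- Union `p ∪ q` of two partial functions (`p` takes precedence; for `blt p q`
the domains are disjoint, so this is the genuine union). -/
def pun {B : Type*} (p q : ℕ → Option B) : ℕ → Option B :=
  fun n => (p n).elim (q n) some

/-- The empty partial function. -/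
def emptyW {B : Type*} : ℕ → Option B := fun _ => none

/-- `p[a]`: substitution of the letter `a ∈ A` for the variable `⋆` in a located
variable word. -/
def substA {A : Type*} (p : ℕ → Option (Option A)) (a : A) : ℕ → Option A :=
  fun n => (p n).map fun x => x.getD a

/-- `p[a]` for `a ∈ A ∪ {⋆}` (with `none` encoding `⋆`, so `p[⋆] = p`). -/
def substV {A : Type*} (p : ℕ → Option (Option A)) (a : Option A) : ℕ → Option (Option A) :=
  fun n => (p n).map fun x => x.elim a some

/-- Union of a finite family of partial functions with pairwise disjoint domains. -/
def famUnion {B : Type*} {k : ℕ} (g : Fin k → ℕ → Option B) : ℕ → Option B :=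
  fun n => ((List.ofFn fun i => g i n).filterMap id).head?

/-- A block sequence: a set of located variable words totally ordered by `<`. -/
def IsBlockSeq {A : Type*} (X : Set (ℕ → Option (Option A))) : Prop :=
  (∀ p ∈ X, IsLVW p) ∧ ∀ p ∈ X, ∀ q ∈ X, p = q ∨ blt p q ∨ blt q p

/-- `[X]_A`: located words of the form `p₀[a₀] ∪ ⋯ ∪ p_k[a_k]` with `p₀ < ⋯ < p_k`
all in `X` and `a₀, …, a_k ∈ A`. -/
def combA {A : Type*} (X : Set (ℕ → Option (Option A))) : Set (ℕ → Option A) :=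
  { q | ∃ (k : ℕ) (p : Fin (k + 1) → ℕ → Option (Option A)) (a : Fin (k + 1) → A),
      (∀ i, p i ∈ X) ∧ (∀ i j : Fin (k + 1), i < j → blt (p i) (p j)) ∧
      q = famUnion fun i => substA (p i) (a i) }

/-- `[X]_{A⋆}`: located variable words of the form `p₀[a₀] ∪ ⋯ ∪ p_k[a_k]` with
`p₀ < ⋯ < p_k` all in `X`, `a₀, …, a_k ∈ A ∪ {⋆}`, and `⋆` used at least once. -/
def combV {A : Type*} (X : Set (ℕ → Option (Option A))) : Set (ℕ → Option (Option A)) :=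
  { q | ∃ (k : ℕ) (p : Fin (k + 1) → ℕ → Option (Option A)) (a : Fin (k + 1) → Option A),
      (∀ i, p i ∈ X) ∧ (∀ i j : Fin (k + 1), i < j → blt (p i) (p j)) ∧
      (∃ i, a i = none) ∧ q = famUnion fun i => substV (p i) (a i) }

/-- `X − F`: the elements of `X` whose domain lies entirely above the domains of
all members of `F`. -/
def sminus {B : Type*} (X F : Set (ℕ → Option B)) : Set (ℕ → Option B) :=
  { q ∈ X | ∀ p ∈ F, blt p q }

/-- `dom q ⊆ [0, ℓ)`. -/
def domBelow {B : Type*} (q : ℕ → Option B) (ℓ : ℕ) : Prop := ∀ n ∈ dom q, n < ℓ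

/-- `dom q ⊆ [m, ∞)`. -/
def domAbove {B : Type*} (q : ℕ → Option B) (m : ℕ) : Prop := ∀ n ∈ dom q, m ≤ n

/-- `S^ℓ_p(f) = S^ℓ_{p'}(g)` for colorings of located words: agreement at `q ∪ p`
vs `q ∪ p'` for every located word `q` with domain contained in `[0, ℓ)`.
(Take `p' = emptyW` to express `S^ℓ_p(f) = S^ℓ(g)`.) -/
def SEq {A C : Type*} (f g : (ℕ → Option A) → C) (ℓ : ℕ) (p p' : ℕ → Option A) : Prop :=
  ∀ q : ℕ → Option A, IsLW q → domBelow q ℓ → f (pun q p) = g (pun q p')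

/-- Variant of `SEq` for colorings that are also defined at the empty located word,
i.e. `q` ranges over `FIN_A(0, ℓ) ∪ {∅}`. -/
def SEq0 {A C : Type*} (f g : (ℕ → Option A) → C) (ℓ : ℕ) (p p' : ℕ → Option A) : Prop :=
  ∀ q : ℕ → Option A, (dom q).Finite → domBelow q ℓ → f (pun q p) = g (pun q p')

/-- A coloring `f` is recurrent if for every `ℓ` there is a located variable word `p`
with domain in `[ℓ, ∞)` such that `S^ℓ_{p[a]}(f) = S^ℓ(f)` for every `a ∈ A`. -/
def Recurrent {A C : Type*} (f : (ℕ → Option A) → C) : Prop :=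
  ∀ ℓ : ℕ, ∃ p : ℕ → Option (Option A), IsLVW p ∧ domAbove p ℓ ∧
    ∀ a : A, SEq f f ℓ (substA p a) emptyW

/-- A coloring `f` is uniformly recurrent if for every `ℓ` there is `m > ℓ` such that
for every `p ∈ FIN_A(m, ∞)` there is `q ∈ FIN_A(ℓ, m)` with `S^ℓ_{q ∪ p}(f) = S^ℓ(f)`. -/
def UnifRecurrent {A C : Type*} (f : (ℕ → Option A) → C) : Prop :=
  ∀ ℓ : ℕ, ∃ m : ℕ, ℓ < m ∧ ∀ p : ℕ → Option A, IsLW p → domAbove p m →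
    ∃ q : ℕ → Option A, IsLW q ∧ domAbove q ℓ ∧ domBelow q m ∧
      SEq f f ℓ (pun q p) emptyW

/-- `f` and `g` are weakly proximal: for every `ℓ` there is `p ∈ FIN_A(ℓ, ∞)` with
`S^ℓ_p(f) = S^ℓ_p(g)`. -/
def WeakProx {A C : Type*} (f g : (ℕ → Option A) → C) : Prop :=
  ∀ ℓ : ℕ, ∃ p : ℕ → Option A, IsLW p ∧ domAbove p ℓ ∧ SEq f g ℓ p p

/-- `g` is strongly proximal to `f`: for every `ℓ` there is a located variable word `p`
with domain in `[ℓ, ∞)` such that `S^ℓ(g) = S^ℓ_{p[a]}(g) = S^ℓ_{p[a]}(f)` for all `a ∈ A`. -/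
def StrongProx {A C : Type*} (g f : (ℕ → Option A) → C) : Prop :=
  ∀ ℓ : ℕ, ∃ p : ℕ → Option (Option A), IsLVW p ∧ domAbove p ℓ ∧
    ∀ a : A, SEq g g ℓ emptyW (substA p a) ∧ SEq g f ℓ (substA p a) (substA p a)

/-- `Recurrent` for colorings also defined at the empty located word. -/
def Recurrent0 {A C : Type*} (f : (ℕ → Option A) → C) : Prop :=
  ∀ ℓ : ℕ, ∃ p : ℕ → Option (Option A), IsLVW p ∧ domAbove p ℓ ∧
    ∀ a : A, SEq0 f f ℓ (substA p a) emptyW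

/-- `StrongProx` for colorings also defined at the empty located word. -/
def StrongProx0 {A C : Type*} (g f : (ℕ → Option A) → C) : Prop :=
  ∀ ℓ : ℕ, ∃ p : ℕ → Option (Option A), IsLVW p ∧ domAbove p ℓ ∧
    ∀ a : A, SEq0 g g ℓ emptyW (substA p a) ∧ SEq0 g f ℓ (substA p a) (substA p a)

/-- Agreement of two colorings on all located words with domain in `[0, ℓ)`. -/
def AgreeBelow {A C : Type*} (f g : (ℕ → Option A) → C) (ℓ : ℕ) : Prop :=
  ∀ q : ℕ → Option A, IsLW q → domBelow q ℓ → f q = g q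

/-- Closedness of a class in `C^{FIN_A}` with the product topology (`C` discrete):
a class is closed iff it contains every coloring all of whose finite restrictions
(to located words with domain in `[0, ℓ)`, for each `ℓ`) are matched within the class. -/
def IsClosedColl {A C : Type*} (𝓒 : Set ((ℕ → Option A) → C)) : Prop :=
  ∀ f, (∀ ℓ : ℕ, ∃ g ∈ 𝓒, AgreeBelow f g ℓ) → f ∈ 𝓒

/-- A subshift: a nonempty closed class `𝓒 ⊆ C^{FIN_A}` such that for every `f ∈ 𝓒`,
`ℓ ∈ ℕ` and `p ∈ FIN_A(ℓ, ∞)` there is `g ∈ 𝓒` with `S^ℓ(g) = S^ℓ_p(f)`. -/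
def IsSubshift {A C : Type*} (𝓒 : Set ((ℕ → Option A) → C)) : Prop :=
  𝓒.Nonempty ∧ IsClosedColl 𝓒 ∧
    ∀ f ∈ 𝓒, ∀ ℓ : ℕ, ∀ p : ℕ → Option A, IsLW p → domAbove p ℓ →
      ∃ g ∈ 𝓒, SEq g f ℓ emptyW p

/-- A minimal subshift: no subshift is a proper subset of it. -/
def IsMinimalSubshift {A C : Type*} (𝓒 : Set ((ℕ → Option A) → C)) : Prop :=
  IsSubshift 𝓒 ∧ ∀ 𝓓 : Set ((ℕ → Option A) → C), IsSubshift 𝓓 → 𝓓 ⊆ 𝓒 → 𝓓 = 𝓒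

/-- The orbit closure of a coloring `f`: all `g` such that for every `ℓ` and every
`q ∈ FIN_A(ℓ, ∞)` there is `p ∈ FIN_A(ℓ, ∞)` with `S^ℓ_q(g) = S^ℓ_p(f)`. -/
def orbCl {A C : Type*} (f : (ℕ → Option A) → C) : Set ((ℕ → Option A) → C) :=
  { g | ∀ ℓ : ℕ, ∀ q : ℕ → Option A, IsLW q → domAbove q ℓ →
      ∃ p : ℕ → Option A, IsLW p ∧ domAbove p ℓ ∧ SEq g f ℓ q p }

/-- A variable word over `A`, encoded as a list over `Option A` with `none` = `⋆`:
the variable must occur at least once. -/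
def IsVarWord {A : Type*} (w : List (Option A)) : Prop := none ∈ w

/-- `w[a]`: replace every occurrence of the variable `⋆` by the letter `a`. -/
def substW {A : Type*} (w : List (Option A)) (a : A) : List A :=
  w.map fun x => x.getD a

/-- `⟨(w_n)_{n∈ℕ}⟩_A`: the words `w_{j₀}[a₀] ⋯ w_{j_{k-1}}[a_{k-1}]` extracted from
the sequence `(w_n)`, for `j₀ < ⋯ < j_{k-1}` and letters `a₀, …, a_{k-1} ∈ A`. -/
def extracted {A : Type*} (w : ℕ → List (Option A)) : Set (List A) :=
  { u | ∃ (k : ℕ) (j : Fin (k + 1) → ℕ) (a : Fin (k + 1) → A),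
      StrictMono j ∧ u = (List.ofFn fun i => substW (w (j i)) (a i)).flatten }

/-- An infinite set of naturals contains finite nonempty subsets lying arbitrarily far out whose
sum is divisible by an arbitrarily large power of two. -/
theorem exists_finset_two_pow_dvd_sum {X : Set ℕ} (hX : X.Infinite) (N : ℕ) :
    ∃ F : Finset ℕ, F.Nonempty ∧ (∀ m ∈ F, m ∈ X ∧ N < m) ∧ 2 ^ N ∣ ∑ m ∈ F, m := by
  have hinf : (X \ Set.Iic N).Infinite := hX.sdiff (Set.finite_Iic N)
  obtain ⟨r, hr⟩ : ∃ r, ((X \ Set.Iic N) ∩ (· % 2 ^ N) ⁻¹' {r}).Infinite := by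
    by_contra! h
    refine hinf (Set.Finite.of_finite_fibers (· % 2 ^ N) ?_ fun r _ => ?_)
    · refine (Set.finite_Iio (2 ^ N)).subset ?_
      rintro _ ⟨x, -, rfl⟩
      exact Nat.mod_lt x (by positivity)
    · simpa using h r
  obtain ⟨F, hF, hcard⟩ := hr.exists_subset_card_eq (2 ^ N)
  refine ⟨F, Finset.card_pos.mp (hcard ▸ by positivity), fun m hm => ?_, ?_⟩
  · simpa using (hF hm).1
  · have hmod : ∀ m ∈ F, m % 2 ^ N = r := fun m hm => (hF hm).2
    rw [Nat.dvd_iff_mod_eq_zero, Finset.sum_nat_mod, Finset.sum_congr rfl hmod]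
    simp [hcard]

/-- A sequence whose terms are divisible by a power of two exceeding the previous term is
2-apart. -/
theorem log_lt_padicValNat_of_two_pow_succ_dvd {s : ℕ → ℕ} (hpos : ∀ n, 0 < s n)
    (hdvd : ∀ n, 2 ^ (s n + 1) ∣ s (n + 1)) {i j : ℕ} (hij : i < j) :
    Nat.log 2 (s i) < padicValNat 2 (s j) := by
  have hmono : StrictMono s := strictMono_nat_of_lt_succ fun n =>
    (Nat.lt_succ_self _).trans
      (Nat.lt_two_pow_self.trans_le (Nat.le_of_dvd (hpos _) (hdvd n)))
  obtain ⟨k, rfl⟩ := Nat.exists_eq_add_of_lt hij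
  have hval : s (i + k) + 1 ≤ padicValNat 2 (s (i + k + 1)) :=
    (padicValNat_dvd_iff_le (hpos _).ne').mp (hdvd _)
  have hle : s i ≤ s (i + k) := hmono.monotone (Nat.le_add_right i k)
  have hlog := Nat.log_le_self 2 (s i)
  omega

/-- For every infinite set `X ⊆ ℕ` there is an infinite 2-apart set `Y ≤_FS X`:
`Y` is the set of sums of a block sequence of finite nonempty subsets of `X`, and for
`a < b` in `Y` we have `μ(a) < λ(b)` (where `μ = Nat.log 2` gives the largest binary
digit and `λ = padicValNat 2` gives the smallest binary digit). -/
theorem exists_two_apart_leFS (X : Set ℕ) (hX : X.Infinite) :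
    ∃ Y : Set ℕ, Y.Infinite ∧
      (∀ a ∈ Y, ∀ b ∈ Y, a < b → Nat.log 2 a < padicValNat 2 b) ∧
      ∃ F : ℕ → Finset ℕ,
        (∀ n, (F n).Nonempty) ∧
        (∀ n, ∀ m ∈ F n, m ∈ X) ∧
        (∀ n, ∀ a ∈ F n, ∀ b ∈ F (n + 1), a < b) ∧
        Y = { s | ∃ n, s = ∑ m ∈ F n, m } := by
  choose f hne hmem hdvd using exists_finset_two_pow_dvd_sum hX
  let F : ℕ → Finset ℕ := fun n => Nat.rec (f 0) (fun _ S => f (∑ m ∈ S, m + 1)) n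
  let s : ℕ → ℕ := fun n => ∑ m ∈ F n, m
  have hF : ∀ n, ∃ N, F n = f N := by
    rintro (_ | n)
    exacts [⟨_, rfl⟩, ⟨_, rfl⟩]
  have hFne : ∀ n, (F n).Nonempty := fun n => by
    obtain ⟨N, hN⟩ := hF n
    exact hN ▸ hne N
  have hFmem : ∀ n, ∀ m ∈ F n, m ∈ X ∧ 0 < m := fun n m hm => by
    obtain ⟨N, hN⟩ := hF n
    have h := hmem N m (hN ▸ hm)
    exact ⟨h.1, by omega⟩
  have hpos : ∀ n, 0 < s n := fun n =>
    Finset.sum_pos (fun m hm => (hFmem n m hm).2) (hFne n)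
  have hsdvd : ∀ n, 2 ^ (s n + 1) ∣ s (n + 1) := fun n => hdvd (s n + 1)
  have happart {i j : ℕ} (hij : i < j) : Nat.log 2 (s i) < padicValNat 2 (s j) :=
    log_lt_padicValNat_of_two_pow_succ_dvd hpos hsdvd hij
  have hmono : StrictMono s := fun i j hij => by
    have hlog := (happart hij).trans_le (padicValNat_le_nat_log (s j))
    exact lt_of_not_ge fun h => hlog.not_ge (Nat.log_mono_right h)
  refine ⟨{t | ∃ n, t = s n}, ?_, ?_, F, hFne, fun n m hm => (hFmem n m hm).1, ?_, rfl⟩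
  · exact (Set.infinite_range_of_injective hmono.injective).mono
      (by rintro _ ⟨n, rfl⟩; exact ⟨n, rfl⟩)
  · rintro _ ⟨i, rfl⟩ _ ⟨j, rfl⟩ hlt
    exact happart (hmono.lt_iff_lt.mp hlt)
  · intro n a ha b hb
    have hle : a ≤ s n := Finset.single_le_sum (f := fun m => m) (fun _ _ => Nat.zero_le _) ha
    have hlt : s n + 1 < b := (hmem (s n + 1) b hb).2
    omega

end Carlson
end

section
/- Let X ⊆ FIN_{A⋆} be an infinite block sequence, let f : [X]_A → C be a coloring into a finite set C, and let i ∈ C. If X is weakly f-thin for color i, then there exists an infinite block sequence Y ⊆ [X]_{A⋆} that is f-thin for color i. -/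
namespace Carlson

/-! ### Idempotents in compact right topological semigroups -/

section Idempotents

variable {G : Type*} [Semigroup G] [TopologicalSpace G] [T2Space G] [CompactSpace G]

/-- A closed subsemigroup of a compact right topological semigroup contains a minimal idempotent. -/
theorem exists_minimal_idempotent (hcont : ∀ r : G, Continuous (· * r)) (S : Set G)
    (hSne : S.Nonempty) (hS : IsClosed S) (hmul : ∀ x ∈ S, ∀ y ∈ S, x * y ∈ S) :
    ∃ u ∈ S, u * u = u ∧ ∀ v ∈ S, v * v = v → v * u = v → u * v = v → v = u := by
  let 𝓛 : Set (Set G) := {L | IsClosed L ∧ L.Nonempty ∧ L ⊆ S ∧ ∀ x ∈ S, ∀ y ∈ L, x * y ∈ L}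
  obtain ⟨L, -, hL⟩ : ∃ L ⊆ S, Minimal (· ∈ 𝓛) L := by
    refine zorn_superset_nonempty 𝓛 (fun c hc hchain hne => ?_) S ⟨hS, hSne, subset_rfl, hmul⟩
    refine ⟨⋂₀ c, ⟨isClosed_sInter fun t ht => (hc ht).1, ?_, ?_, ?_⟩,
      fun s hs => Set.sInter_subset_of_mem hs⟩
    · have : Nonempty c := hne.coe_sort
      rw [Set.sInter_eq_iInter]
      exact IsCompact.nonempty_iInter_of_directed_nonempty_isCompact_isClosed _
        (DirectedOn.directed_val (IsChain.directedOn hchain.symm))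
        (fun i => (hc i.prop).2.1) (fun i => (hc i.prop).1.isCompact) (fun i => (hc i.prop).1)
    · obtain ⟨t, ht⟩ := hne
      exact (Set.sInter_subset_of_mem ht).trans (hc ht).2.2.1
    · exact fun x hx y hy t ht => (hc ht).2.2.2 x hx y (hy t ht)
  obtain ⟨hLc, hLne, hLS, hLmul⟩ := hL.prop
  obtain ⟨u, huL, huu⟩ := exists_idempotent_in_compact_subsemigroup hcont L hLne hLc.isCompact
    fun x hx y hy => hLmul x (hLS hx) y hy
  refine ⟨u, hLS huL, huu, fun v hvS hvv hvu huv => ?_⟩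
  have hvL : v ∈ L := hvu ▸ hLmul v hvS u huL
  have heq : (· * v) '' S = L := by
    apply hL.eq_of_subset
    · refine ⟨(hcont v).isClosedMap _ hS, hSne.image _, ?_, ?_⟩
      · rintro _ ⟨x, hx, rfl⟩
        exact hmul x hx v hvS
      · rintro x hx _ ⟨y, hy, rfl⟩
        exact ⟨x * y, hmul x hx y hy, mul_assoc _ _ _⟩
    · rintro _ ⟨x, hx, rfl⟩
      exact hLmul x hx v hvL
  obtain ⟨t, -, rfl⟩ : u ∈ (· * v) '' S := heq ▸ huL
  simpa [mul_assoc, hvv] using huv.symm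

/-- Below any idempotent `u` of a subsemigroup acting on both sides of the closed semigroup `T`
there is an idempotent in `T`. -/
theorem exists_idempotent_below (hcont : ∀ r : G, Continuous (· * r)) (T : Set G)
    (hTne : T.Nonempty) (hT : IsClosed T) (hmul : ∀ x ∈ T, ∀ y ∈ T, x * y ∈ T) {u : G}
    (huu : u * u = u) (hTu : ∀ x ∈ T, x * u ∈ T) (huT : ∀ x ∈ T, u * x ∈ T) :
    ∃ v ∈ T, v * v = v ∧ v * u = v ∧ u * v = v := by
  obtain ⟨_, ⟨x, hx, rfl⟩, hw⟩ := exists_idempotent_in_compact_subsemigroup hcont ((· * u) '' T)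
    (hTne.image _) ((hcont u).isClosedMap _ hT).isCompact (by
      rintro _ ⟨x, hx, rfl⟩ _ ⟨y, hy, rfl⟩
      exact ⟨x * u * y, hmul _ (hTu x hx) y hy, mul_assoc _ _ _⟩)
  set w := x * u with hwdef
  replace hw : w * w = w := hw
  have hwu : w * u = w := by rw [hwdef, mul_assoc, huu]
  refine ⟨u * w, huT _ (hTu x hx), ?_, ?_, ?_⟩
  · calc u * w * (u * w) = u * (w * u * w) := by simp only [mul_assoc]
      _ = u * w := by rw [hwu, hw]
  · rw [mul_assoc, hwu]
  · rw [← mul_assoc, huu]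

end Idempotents

/-! ### Ultrafilters on a semigroup -/

section Ultrafilters

open Filter

theorem isClosed_ultrafilter_le {M : Type*} (F : Filter M) :
    IsClosed {U : Ultrafilter M | (U : Filter M) ≤ F} := by
  have : {U : Ultrafilter M | (U : Filter M) ≤ F} = ⋂ s ∈ F, {U : Ultrafilter M | s ∈ U} := by
    ext U
    simp [Filter.le_def]
  rw [this]
  exact isClosed_biInter fun s _ => ultrafilter_isClosed_basic s

attribute [local instance] Ultrafilter.mul Ultrafilter.semigroup

variable {M : Type*} [Semigroup M]

theorem ultrafilter_map_mul (φ : M → M) (hφ : ∀ x y, φ (x * y) = φ x * φ y)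
    (U V : Ultrafilter M) : (U * V).map φ = U.map φ * V.map φ := by
  refine Ultrafilter.coe_inj.mp (Filter.ext' fun p => ?_)
  simp only [Ultrafilter.eventually_mul, Ultrafilter.coe_map, Filter.eventually_map, hφ]

theorem ultrafilter_mul_le {F G H : Filter M} (h : ∀ s ∈ H, ∀ᶠ x in F, ∀ᶠ y in G, x * y ∈ s)
    {U V : Ultrafilter M} (hU : (U : Filter M) ≤ F) (hV : (V : Filter M) ≤ G) :
    ((U * V : Ultrafilter M) : Filter M) ≤ H := by
  intro s hs
  have : ∀ᶠ z in ((U * V : Ultrafilter M) : Filter M), z ∈ s := by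
    rw [Ultrafilter.eventually_mul]
    exact hU ((h s hs).mono fun x hx => hV hx)
  exact this

/-- If `FA` and `FV` generate semigroups of ultrafilters, the second being an ideal with respect to
the first, and the homomorphisms `φ a` retract the second onto the first, then some idempotent
ultrafilter finer than `FA` is the common image under all `φ a` of an ultrafilter finer
than `FV`. -/
theorem exists_idempotent_ultrafilter_map_eq {ι : Type*} (φ : ι → M → M)
    (hφ : ∀ a x y, φ a (x * y) = φ a x * φ a y) (FA FV : Filter M) [FA.NeBot] [FV.NeBot]
    (hAA : ∀ s ∈ FA, ∀ᶠ x in FA, ∀ᶠ y in FA, x * y ∈ s)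
    (hAV : ∀ s ∈ FV, ∀ᶠ x in FA, ∀ᶠ y in FV, x * y ∈ s)
    (hVA : ∀ s ∈ FV, ∀ᶠ x in FV, ∀ᶠ y in FA, x * y ∈ s)
    (hVV : ∀ s ∈ FV, ∀ᶠ x in FV, ∀ᶠ y in FV, x * y ∈ s)
    (hmap : ∀ a, Tendsto (φ a) FV FA) (hfix : ∀ a, ∀ᶠ x in FA, φ a x = x) :
    ∃ u v : Ultrafilter M, u * u = u ∧ (v : Filter M) ≤ FV ∧ ∀ a, v.map (φ a) = u := by
  obtain ⟨u, huA, huu, hmin⟩ := exists_minimal_idempotent Ultrafilter.continuous_mul_left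
    {U : Ultrafilter M | (U : Filter M) ≤ FA} ⟨Ultrafilter.of FA, Ultrafilter.of_le FA⟩
    (isClosed_ultrafilter_le FA) fun U hU V hV => ultrafilter_mul_le hAA hU hV
  obtain ⟨v, hvV, hvv, hvu, huv⟩ := exists_idempotent_below Ultrafilter.continuous_mul_left
    {U : Ultrafilter M | (U : Filter M) ≤ FV} ⟨Ultrafilter.of FV, Ultrafilter.of_le FV⟩
    (isClosed_ultrafilter_le FV) (fun U hU V hV => ultrafilter_mul_le hVV hU hV) huu
    (fun U hU => ultrafilter_mul_le hVA hU huA) (fun U hU => ultrafilter_mul_le hAV huA hU)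
  refine ⟨u, v, huu, hvV, fun a => ?_⟩
  have hu : u.map (φ a) = u := by
    refine Ultrafilter.coe_inj.mp ?_
    rw [Ultrafilter.coe_map, Filter.map_congr (huA (hfix a) : φ a =ᶠ[(u : Filter M)] id),
      Filter.map_id]
  refine hmin _ ((Filter.map_mono hvV).trans (hmap a)) ?_ ?_ ?_
  · rw [← ultrafilter_map_mul _ (hφ a), hvv]
  · conv_lhs => rw [← hu]
    rw [← ultrafilter_map_mul _ (hφ a), hvu]
  · conv_lhs => rw [← hu]
    rw [← ultrafilter_map_mul _ (hφ a), huv]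

/-- One step in the construction of a sequence all of whose reduced products lie in an element of
the idempotent ultrafilter `u`. -/
theorem exists_mul_mem_of_map_eq {ι : Type*} [Finite ι] (φ : ι → M → M) {u v : Ultrafilter M}
    (huu : u * u = u) (hmap : ∀ a, v.map (φ a) = u) {s : Set M} (hs : s ∈ u) {t : Set M}
    (ht : t ∈ v) :
    ∃ y ∈ t, (∀ a, φ a y ∈ s) ∧ s ∩ {m | ∀ a, φ a y * m ∈ s} ∈ u := by
  have h₁ : ∀ᶠ x in (u : Filter M), x ∈ s ∧ ∀ᶠ m in (u : Filter M), x * m ∈ s := by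
    refine Filter.Eventually.and hs ?_
    rw [← Ultrafilter.eventually_mul, huu]
    exact hs
  have h₂ : ∀ᶠ y in (v : Filter M), ∀ a, φ a y ∈ s ∧ ∀ᶠ m in (u : Filter M), φ a y * m ∈ s := by
    refine Filter.eventually_all.2 fun a => ?_
    have := h₁
    rwa [← hmap a, Ultrafilter.coe_map, Filter.eventually_map, ← Ultrafilter.coe_map,
      hmap a] at this
  obtain ⟨y, hyt, hy⟩ := (Filter.Eventually.and (show ∀ᶠ y in (v : Filter M), y ∈ t from ht)
    h₂).exists
  exact ⟨y, hyt, fun a => (hy a).1,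
    Filter.inter_mem hs (Filter.eventually_all.2 fun a => (hy a).2)⟩

end Ultrafilters

/-! ### Located words -/

section Words

variable {A B : Type*}

/-- Partial functions form a semigroup under left-biased union. -/
abbrev punSemigroup (B : Type*) : Semigroup (ℕ → Option B) where
  mul := pun
  mul_assoc p q r := by
    funext n
    change pun (pun p q) r n = pun p (pun q r) n
    unfold pun
    cases p n <;> rfl

theorem dom_pun (p q : ℕ → Option B) : dom (pun p q) = dom p ∪ dom q := by
  ext n
  cases h : p n <;> simp [dom, pun, h]

theorem dom_substV (p : ℕ → Option (Option A)) (a : Option A) : dom (substV p a) = dom p := by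
  ext n
  simp [dom, substV]

theorem substV_pun (p q : ℕ → Option (Option A)) (a : Option A) :
    substV (pun p q) a = pun (substV p a) (substV q a) := by
  funext n
  cases h : p n <;> simp [substV, pun, h]

theorem substA_pun (p q : ℕ → Option (Option A)) (a : A) :
    substA (pun p q) a = pun (substA p a) (substA q a) := by
  funext n
  cases h : p n <;> simp [substA, pun, h]

theorem substV_substV (p : ℕ → Option (Option A)) (b : Option A) (a : A) :
    substV (substV p b) (some a) = substV p (some (b.getD a)) := by
  funext n
  rcases h : p n with _ | _ | _ <;> cases b <;> simp [substV, h]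

theorem substA_substV (p : ℕ → Option (Option A)) (a b : A) :
    substA (substV p (some a)) b = substA p a := by
  funext n
  rcases h : p n with _ | _ | _ <;> simp [substV, substA, h]

theorem substV_none (p : ℕ → Option (Option A)) : substV p none = p := by
  funext n
  rcases h : p n with _ | _ | _ <;> simp [substV, h]

theorem famUnion_succ {k : ℕ} (g : Fin (k + 1) → ℕ → Option B) :
    famUnion g = pun (g 0) (famUnion fun i => g i.succ) := by
  funext n
  cases h : g 0 n <;> simp [famUnion, pun, List.ofFn_succ, h]

theorem famUnion_zero (g : Fin 0 → ℕ → Option B) : famUnion g = emptyW := by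
  funext n
  simp [famUnion, emptyW]

theorem pun_emptyW (p : ℕ → Option B) : pun p emptyW = p := by
  funext n
  cases h : p n <;> simp [pun, emptyW, h]

theorem not_blt_self {p : ℕ → Option B} (hp : (dom p).Nonempty) : ¬ blt p p :=
  fun h => hp.elim fun n hn => lt_irrefl n (h n hn n hn)

/-- `p` takes the value `⋆`. -/
def HasStar (p : ℕ → Option (Option A)) : Prop := ∃ n, p n = some none

theorem HasStar.nonempty {p : ℕ → Option (Option A)} (h : HasStar p) : (dom p).Nonempty :=
  h.imp fun n hn => by simp [dom, hn]

theorem HasStar.of_pun {p q : ℕ → Option (Option A)} (h : HasStar (pun p q)) :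
    HasStar p ∨ HasStar q := by
  obtain ⟨n, hn⟩ := h
  cases hp : p n with
  | none => exact Or.inr ⟨n, by simpa [pun, hp] using hn⟩
  | some x => exact Or.inl ⟨n, by simpa [pun, hp] using hn⟩

theorem HasStar.pun_left {p : ℕ → Option (Option A)} (h : HasStar p) (q : ℕ → Option (Option A)) :
    HasStar (pun p q) :=
  h.imp fun n hn => by simp [pun, hn]

theorem HasStar.pun_right {p q : ℕ → Option (Option A)} (h : HasStar q) (hpq : blt p q) :
    HasStar (pun p q) := by
  obtain ⟨n, hn⟩ := h
  refine ⟨n, ?_⟩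
  have hp : p n = none := by
    by_contra hp
    exact lt_irrefl n (hpq n hp n (by simp [dom, hn]))
  simp [pun, hp, hn]

theorem not_hasStar_substV_some (p : ℕ → Option (Option A)) (a : A) :
    ¬ HasStar (substV p (some a)) := by
  rintro ⟨n, hn⟩
  rcases h : p n with _ | _ | _ <;> simp [substV, h] at hn

theorem substV_eq_self {p : ℕ → Option (Option A)} (h : ¬ HasStar p) (a : Option A) :
    substV p a = p := by
  funext n
  rcases hn : p n with _ | _ | _
  · simp [substV, hn]
  · exact absurd ⟨n, hn⟩ h
  · simp [substV, hn]

/-- Located words, with or without variable, generated by `X`. -/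
inductive Generated (X : Set (ℕ → Option (Option A))) : (ℕ → Option (Option A)) → Prop
  | single {x : ℕ → Option (Option A)} (a : Option A) : x ∈ X → Generated X (substV x a)
  | cons {x q : ℕ → Option (Option A)} (a : Option A) : x ∈ X → blt x q → Generated X q →
      Generated X (pun (substV x a) q)

variable {X : Set (ℕ → Option (Option A))}

theorem Generated.finite_dom (hX : IsBlockSeq X) {p : ℕ → Option (Option A)}
    (hp : Generated X p) : (dom p).Finite := by
  induction hp with
  | single a hx => rw [dom_substV]; exact (hX.1 _ hx).1.1
  | cons a hx _ _ ih => rw [dom_pun, dom_substV]; exact (hX.1 _ hx).1.1.union ih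

theorem Generated.pun {p q : ℕ → Option (Option A)} (hp : Generated X p) (hq : Generated X q)
    (hpq : blt p q) : Generated X (pun p q) := by
  induction hp with
  | single a hx =>
    refine .cons a hx ?_ hq
    simpa only [blt, dom_substV] using hpq
  | @cons x r a hx hxr _ ih =>
    rw [show Carlson.pun (Carlson.pun (substV x a) r) q
      = Carlson.pun (substV x a) (Carlson.pun r q) from (punSemigroup _).mul_assoc _ _ _]
    simp only [blt, dom_pun, dom_substV, Set.mem_union] at hpq
    refine .cons a hx ?_ (ih fun m hm n hn => hpq m (Or.inr hm) n hn)
    intro m hm n hn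
    rw [dom_pun] at hn
    exact hn.elim (hxr m hm n) (hpq m (Or.inl hm) n)

theorem Generated.substV {p : ℕ → Option (Option A)} (hp : Generated X p) (a : A) :
    Generated X (substV p (some a)) := by
  induction hp with
  | single b hx => rw [substV_substV]; exact .single _ hx
  | cons b hx hxq _ ih =>
    rw [substV_pun, substV_substV]
    exact .cons _ hx (by simpa only [blt, dom_substV] using hxq) ih

theorem Generated.exists_famUnion {q : ℕ → Option (Option A)} (hq : Generated X q) :
    ∃ (k : ℕ) (p : Fin (k + 1) → ℕ → Option (Option A)) (a : Fin (k + 1) → Option A),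
      (∀ i, p i ∈ X) ∧ (∀ i j : Fin (k + 1), i < j → blt (p i) (p j)) ∧
      (∀ i, dom (p i) ⊆ dom q) ∧ (HasStar q → ∃ i, a i = none) ∧
      q = famUnion fun i => Carlson.substV (p i) (a i) := by
  induction hq with
  | @single x a hx =>
    refine ⟨0, fun _ => x, fun _ => a, fun _ => hx, fun i j hij => ?_, fun _ => ?_, fun h => ?_, ?_⟩
    · omega
    · rw [dom_substV]
    · cases a with
      | none => exact ⟨0, rfl⟩
      | some a => exact absurd h (not_hasStar_substV_some x a)
    · rw [famUnion_succ, famUnion_zero, pun_emptyW]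
  | @cons x r b hx hxr _ ih =>
    obtain ⟨k, p, a, hpX, hp, hdom, hstar, hr⟩ := ih
    refine ⟨k + 1, Fin.cons x p, Fin.cons b a, ?_, ?_, ?_, ?_, ?_⟩
    · exact Fin.cases hx hpX
    · intro i j
      refine Fin.cases ?_ (fun j => ?_) j
      · exact fun h => absurd h (Fin.not_lt_zero i)
      · refine Fin.cases (fun _ => ?_) (fun i hij => ?_) i
        · exact fun m hm n hn => hxr m hm n (hdom j hn)
        · exact hp i j (Fin.succ_lt_succ_iff.1 hij)
    · rw [dom_pun, dom_substV]
      exact Fin.cases Set.subset_union_left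
        fun i => (hdom i).trans Set.subset_union_right
    · intro h
      cases b with
      | none => exact ⟨0, rfl⟩
      | some b =>
        obtain ⟨i, hi⟩ := hstar (h.of_pun.resolve_left (not_hasStar_substV_some x b))
        exact ⟨i.succ, hi⟩
    · rw [famUnion_succ, hr]
      rfl

theorem Generated.mem_combV {q : ℕ → Option (Option A)} (hq : Generated X q) (h : HasStar q) :
    q ∈ combV X := by
  obtain ⟨k, p, a, hpX, hp, -, hstar, hr⟩ := hq.exists_famUnion
  exact ⟨k, p, a, hpX, hp, hstar h, hr⟩

theorem exists_mem_domAbove (hX : IsBlockSeq X) (hXinf : X.Infinite) (n : ℕ) :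
    ∃ x ∈ X, domAbove x n := by
  by_contra! h
  have h' : ∀ x ∈ X, ∃ m ∈ dom x, m < n := fun x hx => by
    simpa [domAbove] using h x hx
  choose! g hg hgn using h'
  obtain ⟨x, hx, y, hy, hne, hxy⟩ :=
    hXinf.exists_ne_map_eq_of_mapsTo (f := g) (t := Set.Iio n) hgn (Set.finite_Iio n)
  rcases hX.2 x hx y hy with h | h | h
  · exact hne h
  · exact (h _ (hg x hx) _ (hg y hy)).ne hxy
  · exact (h _ (hg y hy) _ (hg x hx)).ne' hxy

/-- The generated words which lie above `n` and satisfy `P`. -/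
def tailSet (X : Set (ℕ → Option (Option A))) (P : (ℕ → Option (Option A)) → Prop) (n : ℕ) :
    Set (ℕ → Option (Option A)) :=
  {p | Generated X p ∧ P p ∧ domAbove p n}

/-- The filter of cofinal generated words satisfying `P`. -/
def tailFilter (X : Set (ℕ → Option (Option A))) (P : (ℕ → Option (Option A)) → Prop) :
    Filter (ℕ → Option (Option A)) :=
  ⨅ n, Filter.principal (tailSet X P n)

theorem tailFilter_hasBasis (X : Set (ℕ → Option (Option A)))
    (P : (ℕ → Option (Option A)) → Prop) :
    (tailFilter X P).HasBasis (fun _ => True) (tailSet X P) :=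
  Filter.hasBasis_iInf_principal <| directed_of_isDirected_le fun _ _ hmn _ hp =>
    ⟨hp.1, hp.2.1, fun k hk => hmn.trans (hp.2.2 k hk)⟩

theorem eventually_pun_mem (hX : IsBlockSeq X) {P Q R : (ℕ → Option (Option A)) → Prop}
    (hPQR : ∀ p q, P p → Q q → blt p q → R (pun p q)) :
    ∀ s ∈ tailFilter X R, ∀ᶠ p in tailFilter X P, ∀ᶠ q in tailFilter X Q, pun p q ∈ s := by
  intro s hs
  obtain ⟨n, -, hn⟩ := (tailFilter_hasBasis X R).mem_iff.1 hs
  refine (tailFilter_hasBasis X P).eventually_iff.2 ⟨n, trivial, fun p hp => ?_⟩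
  obtain ⟨b, hb⟩ := (hp.1.finite_dom hX).bddAbove
  refine (tailFilter_hasBasis X Q).eventually_iff.2 ⟨max n (b + 1), trivial, fun q hq => hn ?_⟩
  have hpq : blt p q := fun k hk l hl => by
    have h₁ := hb hk
    have h₂ := hq.2.2 l hl
    omega
  refine ⟨hp.1.pun hq.1 hpq, hPQR p q hp.2.1 hq.2.1 hpq, fun k hk => ?_⟩
  rw [dom_pun] at hk
  exact hk.elim (hp.2.2 k) fun hk => (le_max_left _ _).trans (hq.2.2 k hk)

/-- If the reduced words of a sequence satisfy the recursive condition below, then the words they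
generate stay in the prescribed sets. -/
theorem famUnion_mem {y : ℕ → ℕ → Option (Option A)}
    {s : ℕ → Set (ℕ → Option (Option A))} (hs : Antitone s)
    (hy : ∀ n a, substV (y n) (some a) ∈ s n)
    (hys : ∀ n a, ∀ m ∈ s (n + 1), pun (substV (y n) (some a)) m ∈ s n)
    (k : ℕ) (j : Fin (k + 1) → ℕ) (hj : StrictMono j) (a : Fin (k + 1) → A) :
    famUnion (fun i => substV (y (j i)) (some (a i))) ∈ s (j 0) := by
  induction k with
  | zero =>
    rw [famUnion_succ, famUnion_zero, pun_emptyW]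
    exact hy _ _
  | succ k ih =>
    rw [famUnion_succ]
    refine hys _ _ _ (hs ?_ (ih (fun i => j i.succ) (fun i i' h => hj (Fin.succ_lt_succ_iff.2 h))
      fun i => a i.succ))
    exact hj (Fin.succ_pos 0)

theorem substA_famUnion {k : ℕ} (p : Fin k → ℕ → Option (Option A)) (a : Fin k → A) (b : A) :
    substA (famUnion fun i => substV (p i) (some (a i))) b
      = famUnion fun i => substA (p i) (a i) := by
  induction k with
  | zero =>
    rw [famUnion_zero, famUnion_zero]
    rfl
  | succ k ih =>
    rw [famUnion_succ, famUnion_succ, substA_pun, substA_substV, ih]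

end Words

/-- If an infinite block sequence `X` is weakly `f`-thin for color `i` (for every
`p ∈ [X]_{A⋆}` there is `a ∈ A` with `f(p[a]) ≠ i`), then there is an infinite block
sequence `Y ⊆ [X]_{A⋆}` which is `f`-thin for color `i` (`f(p) ≠ i` for `p ∈ [Y]_A`). -/
theorem thin_of_weakly_thin {A C : Type*} [Fintype A] [Nonempty A] [Fintype C]
    (X : Set (ℕ → Option (Option A))) (hX : IsBlockSeq X) (hXinf : X.Infinite)
    (f : (ℕ → Option A) → C) (i : C)
    (hweak : ∀ p ∈ combV X, ∃ a : A, f (substA p a) ≠ i) :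
    ∃ Y : Set (ℕ → Option (Option A)), Y ⊆ combV X ∧ IsBlockSeq Y ∧ Y.Infinite ∧
      ∀ p ∈ combA Y, f p ≠ i := by
  let := punSemigroup (Option A)
  let := Ultrafilter.semigroup (M := ℕ → Option (Option A))
  let b : A := Classical.arbitrary A
  let φ : A → (ℕ → Option (Option A)) → ℕ → Option (Option A) := fun a p => substV p (some a)
  let FV := tailFilter X HasStar
  let FA := tailFilter X fun p => ¬ HasStar p
  have hFV : FV.NeBot := (tailFilter_hasBasis X _).neBot_iff.2 fun {n} _ => by
    obtain ⟨x, hx, hxn⟩ := exists_mem_domAbove hX hXinf n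
    exact ⟨x, substV_none x ▸ .single none hx, (hX.1 x hx).2, hxn⟩
  have hmap : ∀ a, Filter.Tendsto (φ a) FV FA := fun a =>
    ((tailFilter_hasBasis X _).tendsto_iff (tailFilter_hasBasis X _)).2 fun n _ =>
      ⟨n, trivial, fun p hp => ⟨hp.1.substV a, not_hasStar_substV_some p a,
        fun k hk => hp.2.2 k (dom_substV p (some a) ▸ hk)⟩⟩
  have hFA : FA.NeBot := (hmap b).neBot
  obtain ⟨u, v, huu, hv, hvu⟩ := exists_idempotent_ultrafilter_map_eq φ
    (fun a p q => substV_pun p q (some a)) FA FV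
    (eventually_pun_mem hX fun p q hp hq _ h => h.of_pun.elim hp hq)
    (eventually_pun_mem hX fun p q _ hq h => hq.pun_right h)
    (eventually_pun_mem hX fun p q hp _ _ => hp.pun_left q)
    (eventually_pun_mem hX fun p q hp _ _ => hp.pun_left q) hmap
    (fun a => (tailFilter_hasBasis X _).eventually_iff.2
      ⟨0, trivial, fun p hp => substV_eq_self hp.2.1 _⟩)
  have htail : ∀ n, tailSet X HasStar n ∈ v := fun n =>
    hv ((tailFilter_hasBasis X _).mem_of_mem trivial)
  have hQ : {p | f (substA p b) ≠ i} ∈ u := by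
    by_contra hQ
    obtain ⟨p, hp, hpi, -⟩ := exists_mul_mem_of_map_eq φ huu hvu
      (Ultrafilter.compl_mem_iff_notMem.2 hQ) (htail 0)
    obtain ⟨a, ha⟩ := hweak p (hp.1.mem_combV hp.2.1)
    refine hpi a ?_
    simpa only [φ, Set.mem_ofPred_eq, substA_substV] using ha
  have hstep : ∀ st : {s : Set (ℕ → Option (Option A)) // s ∈ u} × ℕ,
      ∃ (y : ℕ → Option (Option A)) (st' : {s : Set (ℕ → Option (Option A)) // s ∈ u} × ℕ),
        y ∈ tailSet X HasStar st.2 ∧ domBelow y st'.2 ∧ st.2 ≤ st'.2 ∧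
        (∀ a, substV y (some a) ∈ st.1.1) ∧ st'.1.1 ⊆ st.1.1 ∧
        ∀ a, ∀ m ∈ st'.1.1, pun (substV y (some a)) m ∈ st.1.1 := by
    rintro ⟨⟨s, hs⟩, n⟩
    obtain ⟨y, hy, hys, hs'⟩ := exists_mul_mem_of_map_eq φ huu hvu hs (htail n)
    obtain ⟨c, hc⟩ := (hy.1.finite_dom hX).bddAbove
    refine ⟨y, ⟨⟨_, hs'⟩, max n (c + 1)⟩, hy, fun k hk => ?_, le_max_left _ _, hys,
      Set.inter_subset_left, fun a m hm => hm.2 a⟩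
    exact lt_max_of_lt_right (Nat.lt_succ_of_le (hc hk))
  choose Y next hY hYlt hle hYs hanti hYmul using hstep
  let st : ℕ → {s : Set (ℕ → Option (Option A)) // s ∈ u} × ℕ :=
    fun n => next^[n] ⟨⟨_, hQ⟩, 0⟩
  have hst : ∀ n, st (n + 1) = next (st n) := fun n => Function.iterate_succ_apply' _ _ _
  have hs : Antitone fun n => (st n).1.1 := antitone_nat_of_succ_le fun n => by
    simp only [hst]
    exact hanti _
  have hN : Monotone fun n => (st n).2 := monotone_nat_of_le_succ fun n => by
    simp only [hst]
    exact hle _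
  have hblt : ∀ m n, m < n → blt (Y (st m)) (Y (st n)) := fun m n hmn k hk l hl => by
    have h₁ := hYlt (st m) k hk
    rw [← hst] at h₁
    exact h₁.trans_le ((hN (Nat.succ_le_of_lt hmn)).trans ((hY (st n)).2.2 l hl))
  have hne : ∀ n, (dom (Y (st n))).Nonempty := fun n => (hY (st n)).2.1.nonempty
  have hlt : ∀ m n, blt (Y (st m)) (Y (st n)) → m < n := fun m n h => by
    rcases lt_trichotomy m n with h' | rfl | h'
    · exact h'
    · exact absurd h (not_blt_self (hne m))
    · obtain ⟨k, hk⟩ := hne m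
      obtain ⟨l, hl⟩ := hne n
      exact absurd (h k hk l hl) (hblt n m h' l hl k hk).not_gt
  refine ⟨Set.range fun n => Y (st n), ?_, ⟨?_, ?_⟩, Set.infinite_range_of_injective ?_, ?_⟩
  · rintro _ ⟨n, rfl⟩
    exact (hY _).1.mem_combV (hY _).2.1
  · rintro _ ⟨n, rfl⟩
    exact ⟨⟨(hY _).1.finite_dom hX, hne n⟩, (hY _).2.1⟩
  · rintro _ ⟨m, rfl⟩ _ ⟨n, rfl⟩
    rcases lt_trichotomy m n with h | rfl | h
    · exact Or.inr (Or.inl (hblt m n h))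
    · exact Or.inl rfl
    · exact Or.inr (Or.inr (hblt n m h))
  · intro m n hmn
    by_contra hmn'
    rcases lt_or_gt_of_ne hmn' with h | h
    · exact not_blt_self (hne m) ((congrArg (blt (Y (st m))) hmn).mpr (hblt m n h))
    · exact not_blt_self (hne n) ((congrArg (blt (Y (st n))) hmn).mp (hblt n m h))
  · rintro _ ⟨k, p, a, hp, hpblt, rfl⟩
    choose j hj using hp
    obtain rfl : (fun l => Y (st (j l))) = p := funext hj
    have hmem := famUnion_mem (y := fun n => Y (st n)) hs (fun n => hYs (st n))
      (fun n a m hm => hYmul (st n) a m (by rwa [← hst])) k j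
      (fun l l' h => hlt _ _ (hpblt l l' h)) a
    have := hs (Nat.zero_le (j 0)) hmem
    rw [← substA_famUnion _ _ b]
    exact this

end Carlson
end

section
/- If a coloring f : FIN_A → C into a finite set C is uniformly recurrent, then f is recurrent. -/
namespace Carlson

/-- The partial function with domain `[m, m + N)` listing the values of `x` along an
enumeration `e` of its index type. -/
def place {ι B : Type*} {N : ℕ} (m : ℕ) (e : ι ≃ Fin N) (x : ι → B) : ℕ → Option B :=
  fun n => if h : m ≤ n ∧ n - m < N then some (x (e.symm ⟨n - m, h.2⟩)) else none

lemma place_add {ι B : Type*} {N : ℕ} (m : ℕ) (e : ι ≃ Fin N) (x : ι → B) (i : ι) :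
    place m e x (m + e i) = some (x i) := by
  simp [place]

lemma mem_dom_place {ι B : Type*} {N : ℕ} {m : ℕ} {e : ι ≃ Fin N} {x : ι → B} {n : ℕ} :
    n ∈ dom (place m e x) ↔ m ≤ n ∧ n - m < N := by
  simp [dom, place]

lemma isLW_place {ι B : Type*} [Nonempty ι] {N : ℕ} (m : ℕ) (e : ι ≃ Fin N) (x : ι → B) :
    IsLW (place m e x) := by
  refine ⟨(Set.finite_Iio (m + N)).subset fun n hn => ?_, ?_⟩
  · have := mem_dom_place.1 hn
    simp only [Set.mem_Iio]
    omega
  · obtain ⟨i⟩ := ‹Nonempty ι›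
    exact ⟨m + e i, by simp [dom, place_add]⟩

lemma domAbove_place {ι B : Type*} {N : ℕ} (m : ℕ) (e : ι ≃ Fin N) (x : ι → B) :
    domAbove (place m e x) m :=
  fun _ hn => (mem_dom_place.1 hn).1

lemma substA_place {ι A : Type*} {N : ℕ} (m : ℕ) (e : ι ≃ Fin N) (l : Combinatorics.Line A ι)
    (a : A) : substA (place m e l.idxFun) a = place m e (l a) := by
  funext n
  by_cases h : m ≤ n ∧ n - m < N <;> simp [substA, place, h]

lemma mem_dom_pun {B : Type*} {p q : ℕ → Option B} {n : ℕ} :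
    n ∈ dom (pun p q) ↔ n ∈ dom p ∨ n ∈ dom q := by
  cases h : p n <;> simp [dom, pun, h]

lemma IsLW.pun {B : Type*} {p q : ℕ → Option B} (hp : IsLW p) (hq : IsLW q) :
    IsLW (pun p q) :=
  ⟨(hp.1.union hq.1).subset fun _ hn => mem_dom_pun.1 hn,
    hp.2.mono fun _ hn => mem_dom_pun.2 (Or.inl hn)⟩

/-- A located word viewed as a partial function not using the variable. -/
def lift {A : Type*} (q : ℕ → Option A) : ℕ → Option (Option A) :=
  fun n => (q n).map some

lemma dom_lift {A : Type*} (q : ℕ → Option A) : dom (lift q) = dom q := by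
  ext n
  simp [dom, lift]

lemma substA_pun_lift {A : Type*} (q : ℕ → Option A) (v : ℕ → Option (Option A)) (a : A) :
    substA (pun (lift q) v) a = pun q (substA v a) := by
  funext n
  cases h : q n <;> simp [substA, pun, lift, h]

lemma eq_of_domBelow {B : Type*} {p q : ℕ → Option B} {m : ℕ} (hp : domBelow p m)
    (hq : domBelow q m) (h : ∀ i : Fin m, p i = q i) : p = q := by
  funext n
  by_cases hn : n < m
  · exact h ⟨n, hn⟩
  · have h₁ : p n = none := by_contra fun h' => hn (hp n h')
    have h₂ : q n = none := by_contra fun h' => hn (hq n h')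
    rw [h₁, h₂]

/-- A uniformly recurrent coloring is recurrent. -/
theorem recurrent_of_unifRecurrent {A C : Type*} [Fintype A] [Nonempty A] [Fintype C]
    (f : (ℕ → Option A) → C) (hf : UnifRecurrent f) : Recurrent f := by
  intro ℓ
  obtain ⟨m, hℓm, hm⟩ := hf ℓ
  obtain ⟨ι, _, hι⟩ :=
    Combinatorics.Line.exists_mono_in_high_dimension A (Fin m → Option A)
  have : Nonempty ι := by
    obtain ⟨l, -⟩ := hι fun _ _ => none
    exact ⟨l.proper.choose⟩
  let e := Fintype.equivFin ι
  choose q hq hqℓ hqm hqf using fun x : ι → A =>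
    hm (place m e x) (isLW_place m e x) (domAbove_place m e x)
  obtain ⟨l, c, hc⟩ := hι fun x i => q x i
  let a₀ : A := Classical.arbitrary A
  have hconst (a : A) : q (l a) = q (l a₀) :=
    eq_of_domBelow (hqm _) (hqm _) fun i => congrFun ((hc a).trans (hc a₀).symm) i
  have hlift : IsLW (lift (q (l a₀))) := by
    simpa only [IsLW, dom_lift] using hq (l a₀)
  refine ⟨pun (lift (q (l a₀))) (place m e l.idxFun),
    ⟨hlift.pun (isLW_place m e _), ?_⟩, ?_, fun a => ?_⟩
  · obtain ⟨i, hi⟩ := l.proper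
    have hnone : q (l a₀) (m + e i) = none := by
      by_contra h
      have := hqm _ _ h
      omega
    exact ⟨m + e i, by simp [pun, lift, hnone, place_add, hi]⟩
  · intro n hn
    rcases mem_dom_pun.1 hn with h | h
    · rw [dom_lift] at h
      exact hqℓ _ n h
    · exact hℓm.le.trans (domAbove_place m e _ n h)
  · rw [substA_pun_lift, substA_place, ← hconst a]
    exact hqf (l a)

end Carlson
end
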